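/- Let Θ be a measurable space, π₀ a probability measure on Θ, n ≥ 2 a natural number, and X₁, …, X_n fixed data points in a set 𝒳. Suppose the loss ℓ : Θ × 𝒳 → ℝ is such that θ ↦ ℓ(θ, X_i) is bounded and measurable for each i. For t ∈ {1, …, n−1} define r^{(t)}(θ) = (1/t) Σ_{i=1}^{t} ℓ(θ, X_i), let π_α^{(t)} be the probability measure with density proportional to exp(-α r^{(t)}(θ)) with respect to π₀, and let ℰ(α, t) = E_{θ∼π_α^{(t)}}[ℓ(θ, X_{t+1})]. Then the SafeBayes objective 𝒮(α) = Σ_{t=1}^{n−1} ℰ(α, t) is differentiable at every real α with derivative 𝒮'(α) = -Σ_{t=1}^{n−1} Cov_{θ∼π_α^{(t)}}[ℓ(θ, X_{t+1}), r^{(t)}(θ)]. -/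

import Mathlib

open MeasureTheory Real

/-- The tempered (α-)posterior: the measure on Θ whose density with respect to the
prior `π₀` is `exp (-α * f θ) / ∫ exp (-α * f) dπ₀`. -/
noncomputable def temperedPosterior {Θ : Type*} [MeasurableSpace Θ]
    (π₀ : Measure Θ) (f : Θ → ℝ) (α : ℝ) : Measure Θ :=
  π₀.withDensity (fun θ => ENNReal.ofReal
    (Real.exp (-α * f θ) / ∫ θ', Real.exp (-α * f θ') ∂π₀))

/-- The empirical risk up to observation `t`:
`r^{(t)}(θ) = (1/t) ∑_{i=1}^{t} ℓ(θ, X_i)`. -/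
noncomputable def empRisk {Θ 𝒳 : Type*} (ℓ : Θ → 𝒳 → ℝ) (X : ℕ → 𝒳) (t : ℕ) (θ : Θ) : ℝ :=
  (1 / (t : ℝ)) * ∑ i ∈ Finset.Icc 1 t, ℓ θ (X i)

theorem integrable_of_bounded {Θ : Type*} [MeasurableSpace Θ] {μ : Measure Θ}
    [IsFiniteMeasure μ] {g : Θ → ℝ} (hg : Measurable g) {C : ℝ} (hC : ∀ θ, |g θ| ≤ C) :
    Integrable g μ :=
  Integrable.of_bound hg.aestronglyMeasurable C (ae_of_all _ hC)

theorem exp_neg_mul_le_of_bounded {a b y D : ℝ} (ha : |a| ≤ b) (hy : |y| ≤ D) :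
    Real.exp (-a * y) ≤ Real.exp (b * D) := by
  refine Real.exp_le_exp.mpr ((le_abs_self _).trans ?_)
  rw [abs_mul, abs_neg]
  exact mul_le_mul ha hy (abs_nonneg _) ((abs_nonneg _).trans ha)

/-- Differentiation under the integral sign for bounded functions weighted by `exp (-a * f)`. -/
theorem hasDerivAt_integral_exp_neg_mul {Θ : Type*} [MeasurableSpace Θ] {μ : Measure Θ}
    [IsFiniteMeasure μ] {f g : Θ → ℝ} (hf : Measurable f) (hg : Measurable g) {C D : ℝ}
    (hC : ∀ θ, |g θ| ≤ C) (hD : ∀ θ, |f θ| ≤ D) (α : ℝ) :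
    HasDerivAt (fun a => ∫ θ, Real.exp (-a * f θ) * g θ ∂μ)
      (-∫ θ, Real.exp (-α * f θ) * (g θ * f θ) ∂μ) α := by
  have hmeas (a : ℝ) : Measurable fun θ => Real.exp (-a * f θ) :=
    (hf.const_mul (-a)).exp
  rw [← integral_neg]
  refine (hasDerivAt_integral_of_dominated_loc_of_deriv_le
    (F' := fun a θ => -(Real.exp (-a * f θ) * (g θ * f θ)))
    (bound := fun _ => Real.exp ((|α| + 1) * D) * (C * D))
    (Metric.ball_mem_nhds α one_pos)
    (Filter.Eventually.of_forall fun a => ((hmeas a).mul hg).aestronglyMeasurable) ?_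
    ((hmeas α).mul (hg.mul hf)).neg.aestronglyMeasurable ?_ (integrable_const _) ?_).2
  · refine integrable_of_bounded ((hmeas α).mul hg) (C := Real.exp (|α| * D) * C) fun θ => ?_
    rw [Pi.mul_apply, abs_mul, Real.abs_exp]
    exact mul_le_mul (exp_neg_mul_le_of_bounded le_rfl (hD θ)) (hC θ) (abs_nonneg _)
      (Real.exp_pos _).le
  · refine ae_of_all _ fun θ a ha => ?_
    have hab : |a| ≤ |α| + 1 := by
      rw [Metric.mem_ball, Real.dist_eq] at ha
      linarith [abs_sub_abs_le_abs_sub a α]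
    rw [norm_neg, Real.norm_eq_abs, abs_mul, Real.abs_exp, abs_mul]
    exact mul_le_mul (exp_neg_mul_le_of_bounded hab (hD θ))
      (mul_le_mul (hC θ) (hD θ) (abs_nonneg _) ((abs_nonneg _).trans (hC θ)))
      (by positivity) (Real.exp_pos _).le
  · refine ae_of_all _ fun θ a _ => ?_
    have h := (((hasDerivAt_id a).neg.mul_const (f θ)).exp).mul_const (g θ)
    refine h.congr_deriv ?_
    simp only [Pi.neg_apply, id_eq]
    ring

theorem integral_temperedPosterior {Θ : Type*} [MeasurableSpace Θ] (π₀ : Measure Θ)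
    (f g : Θ → ℝ) (α : ℝ) :
    ∫ θ, g θ ∂(temperedPosterior π₀ f α) =
      (∫ θ, Real.exp (-α * f θ) * g θ ∂π₀) / ∫ θ, Real.exp (-α * f θ) ∂π₀ := by
  have h : temperedPosterior π₀ f α = π₀.tilted fun θ => -α * f θ := rfl
  rw [h, integral_tilted, ← integral_div]
  refine integral_congr_ae (ae_of_all _ fun θ => ?_)
  simp only [smul_eq_mul]
  ring

/-- The derivative in `α` of a tempered-posterior expectation is minus a covariance. -/
theorem hasDerivAt_integral_temperedPosterior {Θ : Type*} [MeasurableSpace Θ] {π₀ : Measure Θ}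
    [IsProbabilityMeasure π₀] {f g : Θ → ℝ} (hf : Measurable f) (hg : Measurable g) {C D : ℝ}
    (hC : ∀ θ, |g θ| ≤ C) (hD : ∀ θ, |f θ| ≤ D) (α : ℝ) :
    HasDerivAt (fun a => ∫ θ, g θ ∂(temperedPosterior π₀ f a))
      (-((∫ θ, g θ * f θ ∂(temperedPosterior π₀ f α))
        - (∫ θ, g θ ∂(temperedPosterior π₀ f α)) * ∫ θ, f θ ∂(temperedPosterior π₀ f α))) α := by
  simp only [integral_temperedPosterior]
  have hint : Integrable (fun θ => Real.exp (-α * f θ)) π₀ :=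
    integrable_of_bounded (hf.const_mul (-α)).exp (C := Real.exp (|α| * D)) fun θ => by
      rw [Real.abs_exp]
      exact exp_neg_mul_le_of_bounded le_rfl (hD θ)
  have hpos : (∫ θ, Real.exp (-α * f θ) ∂π₀) ≠ 0 := (integral_exp_pos hint).ne'
  have hnum := hasDerivAt_integral_exp_neg_mul (μ := π₀) hf hg hC hD α
  have hden := hasDerivAt_integral_exp_neg_mul (μ := π₀) (g := fun _ => 1) (C := 1) hf
    measurable_const (by simp) hD α
  simp only [mul_one, one_mul] at hden
  refine (hnum.fun_div hden hpos).congr_deriv ?_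
  field_simp
  ring

theorem measurable_empRisk {Θ 𝒳 : Type*} [MeasurableSpace Θ] {ℓ : Θ → 𝒳 → ℝ} {X : ℕ → 𝒳}
    (hmeas : ∀ i, Measurable (fun θ => ℓ θ (X i))) (t : ℕ) : Measurable (empRisk ℓ X t) :=
  (Finset.measurable_fun_sum _ fun i _ => hmeas i).const_mul _

theorem exists_abs_empRisk_le {Θ 𝒳 : Type*} {ℓ : Θ → 𝒳 → ℝ} {X : ℕ → 𝒳}
    (hbdd : ∀ i, ∃ C : ℝ, ∀ θ, |ℓ θ (X i)| ≤ C) (t : ℕ) :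
    ∃ D : ℝ, ∀ θ, |empRisk ℓ X t θ| ≤ D := by
  choose C hC using hbdd
  refine ⟨|1 / (t : ℝ)| * ∑ i ∈ Finset.Icc 1 t, C i, fun θ => ?_⟩
  rw [empRisk, abs_mul]
  exact mul_le_mul_of_nonneg_left ((Finset.abs_sum_le_sum_abs _ _).trans
    (Finset.sum_le_sum fun i _ => hC i θ)) (abs_nonneg _)

/-- The SafeBayes objective `𝒮(α) = ∑_{t=1}^{n-1} ℰ(α, t)` is differentiable, with
derivative `-∑_{t=1}^{n-1} Cov_{π_α^{(t)}}[ℓ(·, X_{t+1}), r^{(t)}]`. -/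
theorem safeBayes_objective_hasDerivAt
    {Θ 𝒳 : Type*} [MeasurableSpace Θ] (π₀ : Measure Θ) [IsProbabilityMeasure π₀]
    (n : ℕ) (hn : 2 ≤ n) (X : ℕ → 𝒳) (ℓ : Θ → 𝒳 → ℝ)
    (hmeas : ∀ i, Measurable (fun θ => ℓ θ (X i)))
    (hbdd : ∀ i, ∃ C : ℝ, ∀ θ, |ℓ θ (X i)| ≤ C) (α : ℝ) :
    HasDerivAt
      (fun a => ∑ t ∈ Finset.Icc 1 (n - 1),
        ∫ θ, ℓ θ (X (t + 1)) ∂(temperedPosterior π₀ (empRisk ℓ X t) a))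
      (-∑ t ∈ Finset.Icc 1 (n - 1),
        ((∫ θ, ℓ θ (X (t + 1)) * empRisk ℓ X t θ ∂(temperedPosterior π₀ (empRisk ℓ X t) α))
          - (∫ θ, ℓ θ (X (t + 1)) ∂(temperedPosterior π₀ (empRisk ℓ X t) α))
            * (∫ θ, empRisk ℓ X t θ ∂(temperedPosterior π₀ (empRisk ℓ X t) α)))) α := by
  rw [← Finset.sum_neg_distrib]
  refine HasDerivAt.fun_sum fun t _ => ?_
  obtain ⟨C, hC⟩ := hbdd (t + 1)
  obtain ⟨D, hD⟩ := exists_abs_empRisk_le hbdd t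
  exact hasDerivAt_integral_temperedPosterior (measurable_empRisk hmeas t) (hmeas (t + 1)) hC hD α
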